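/- Bernstein-type Rademacher symmetrized concentration inequality (Proposition 5): Let X₁,…,X_n be i.i.d. with law P on a measurable space (S, 𝒜), let ℱ be a countable class of measurable functions S → ℝ uniformly bounded by 1/2, and let σ² ≥ sup_{f∈ℱ} E f²(X₁). Let (ε_i)_{i=1}^n be i.i.d. Rademacher random variables independent of (X_i). Then for every n ∈ ℕ and every x > 0, Pr{ sup_{f∈ℱ} |n^{−1} Σ_{i=1}^n (f(X_i) − Pf)| ≥ 6 sup_{f∈ℱ} |n^{−1} Σ_{i=1}^n ε_i f(X_i)| + 10 √((x + log 2)σ²/n) + 22 (x + log 2)/n } ≤ e^{−x}, where Pf = ∫ f dP. -/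

import Mathlib

open MeasureTheory Filter

noncomputable section

/-- Rademacher law on `ℝ`: `P(ε = 1) = P(ε = −1) = 1/2`. -/
def radMeasure : Measure ℝ :=
  (2 : ENNReal)⁻¹ • (Measure.dirac (1 : ℝ) + Measure.dirac (-1 : ℝ))

lemma one_add_exp_mul_le {d z : ℝ} (hd : 0 ≤ d) (hd1 : d ≤ 1) (hz : z = d - d ^ 2 / 2) :
    (1 + Real.exp z) * (1 + Real.exp (-d)) ≤ 4 := by
  have key : ∀ y : ℝ, 1 + Real.exp y ≤ 2 * Real.exp (y / 2 + y ^ 2 / 8) := by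
    intro y
    have h := Real.cosh_le_exp_half_sq (y / 2)
    rw [Real.cosh_eq] at h
    have h1 : Real.exp (y / 2) * Real.exp (y / 2) = Real.exp y := by
      rw [← Real.exp_add]; ring_nf
    have h2 : Real.exp (y / 2) * Real.exp (-(y / 2)) = 1 := by
      rw [← Real.exp_add]; simp
    have h3 : y / 2 + y ^ 2 / 8 = y / 2 + (y / 2) ^ 2 / 2 := by ring
    rw [h3, Real.exp_add]
    nlinarith [Real.exp_pos (y / 2)]
  calc (1 + Real.exp z) * (1 + Real.exp (-d))
      ≤ (2 * Real.exp (z / 2 + z ^ 2 / 8)) * (2 * Real.exp (-d / 2 + (-d) ^ 2 / 8)) := by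
        gcongr
        · exact key z
        · exact key (-d)
    _ = 4 * Real.exp ((z / 2 + z ^ 2 / 8) + (-d / 2 + (-d) ^ 2 / 8)) := by
        rw [Real.exp_add (z / 2 + z ^ 2 / 8)]; ring
    _ ≤ 4 * Real.exp 0 := by
        gcongr
        have hz0 : 0 ≤ z := by nlinarith
        have hzd : z ≤ d := by nlinarith
        nlinarith
    _ = 4 := by simp

lemma two_point_of_le {A B V₁ V₂ : ℝ} (hAB : A ≤ B) (h₁ : V₁ ≤ Real.exp A)
    (h₂ : ∀ θ : ℝ, 0 ≤ θ → θ ≤ 1 → V₂ ≤ Real.exp (θ ^ 2 / 2 + θ * A + (1 - θ) * B)) :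
    (V₁ + V₂) * (Real.exp (-A) + Real.exp (-B)) ≤ 4 := by
  have reduce : ∀ z : ℝ, V₂ ≤ Real.exp (A + z) →
      (V₁ + V₂) * (Real.exp (-A) + Real.exp (-B)) ≤
        (1 + Real.exp z) * (1 + Real.exp (-(B - A))) := by
    intro z hz
    calc (V₁ + V₂) * (Real.exp (-A) + Real.exp (-B))
        ≤ (Real.exp A + Real.exp (A + z)) * (Real.exp (-A) + Real.exp (-B)) := by gcongr
      _ = _ := by
        have e1 : Real.exp (-B) = Real.exp (-(B - A)) * Real.exp (-A) := by
          rw [← Real.exp_add]; ring_nf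
        have e2 : Real.exp A * Real.exp (-A) = 1 := by rw [← Real.exp_add]; simp
        rw [e1, Real.exp_add]
        linear_combination (1 + Real.exp z) * (1 + Real.exp (-(B - A))) * e2
  rcases le_total (B - A) 1 with hd | hd
  · refine (reduce ((B - A) - (B - A) ^ 2 / 2) ((h₂ (B - A) (by linarith) hd).trans_eq ?_)).trans
      (one_add_exp_mul_le (by linarith) hd rfl)
    congr 1; ring
  · refine (reduce (1 / 2) ((h₂ 1 (by norm_num) le_rfl).trans_eq ?_)).trans ?_
    · congr 1; ring
    · refine le_trans ?_ (one_add_exp_mul_le (d := 1) (z := 1 / 2) (by norm_num) le_rfl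
        (by norm_num))
      gcongr

lemma two_point {A B V₁ V₂ : ℝ}
    (h₁ : ∀ θ : ℝ, 0 ≤ θ → θ ≤ 1 → V₁ ≤ Real.exp ((1 - θ) ^ 2 / 2 + θ * A + (1 - θ) * B))
    (h₂ : ∀ θ : ℝ, 0 ≤ θ → θ ≤ 1 → V₂ ≤ Real.exp (θ ^ 2 / 2 + θ * A + (1 - θ) * B)) :
    (V₁ + V₂) * (Real.exp (-A) + Real.exp (-B)) ≤ 4 := by
  rcases le_total A B with h | h
  · exact two_point_of_le h (by simpa using h₁ 1 zero_le_one le_rfl) h₂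
  · rw [add_comm V₁, add_comm (Real.exp (-A))]
    refine two_point_of_le h (by simpa using h₂ 0 le_rfl zero_le_one) fun θ h0 h1 => ?_
    refine (h₁ (1 - θ) (by linarith) (by linarith)).trans_eq ?_
    congr 1; ring

lemma sum_fin_succ_pi {β : Type*} [Fintype β] {n : ℕ} (f : (Fin (n + 1) → β) → ℝ) :
    ∑ ω, f ω = ∑ b : β, ∑ ω : Fin n → β, f (Fin.cons b ω) := by
  rw [← Fintype.sum_prod_type' (f := fun b ω => f (Fin.cons b ω))]
  exact (Fintype.sum_equiv (Fin.consEquiv fun _ => β) _ _ fun _ => rfl).symm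

lemma sum_pi_exp_iSup_le {T β : Type*} [Fintype β] (n : ℕ) (v z : Fin n → β → T → ℝ)
    (h : ∀ i (c : T → ℝ), ∑ b, Real.exp (⨆ t, (c t + v i b t)) ≤
      ∑ b, Real.exp (⨆ t, (c t + z i b t)))
    (c : T → ℝ) :
    ∑ ω : Fin n → β, Real.exp (⨆ t, (c t + ∑ i, v i (ω i) t)) ≤
      ∑ ω : Fin n → β, Real.exp (⨆ t, (c t + ∑ i, z i (ω i) t)) := by
  induction n generalizing c with
  | zero => simp
  | succ n ih =>
    simp only [sum_fin_succ_pi, Fin.sum_univ_succ, Fin.cons_zero, Fin.cons_succ]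
    calc _ = ∑ ω : Fin n → β, ∑ b,
          Real.exp (⨆ t, ((c t + ∑ i : Fin n, v i.succ (ω i) t) + v 0 b t)) := by
          rw [Finset.sum_comm]
          simp only [add_assoc, add_comm (v 0 _ _)]
      _ ≤ ∑ ω : Fin n → β, ∑ b,
          Real.exp (⨆ t, ((c t + ∑ i : Fin n, v i.succ (ω i) t) + z 0 b t)) :=
          Finset.sum_le_sum fun ω _ => h 0 _
      _ = ∑ b, ∑ ω : Fin n → β,
          Real.exp (⨆ t, ((c t + z 0 b t) + ∑ i : Fin n, v i.succ (ω i) t)) := by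
          rw [Finset.sum_comm]
          simp only [add_assoc, add_comm (z 0 _ _)]
      _ ≤ ∑ b, ∑ ω : Fin n → β,
          Real.exp (⨆ t, ((c t + z 0 b t) + ∑ i : Fin n, z i.succ (ω i) t)) :=
          Finset.sum_le_sum fun b _ => ih _ _ (fun i => h i.succ) _
      _ = _ := by simp only [add_assoc]

section

variable {T : Type*} [Finite T]

lemma le_iSup_of_finite (f : T → ℝ) (t : T) : f t ≤ ⨆ s, f s :=
  le_ciSup (Set.finite_range f).bddAbove t

/-- Maurey's infimum-convolution property for a uniformly distributed finite family of random
functions `X ω` on `T`, in its dual form with penalty `pen`. -/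
def InfConv {Ω : Type*} [Fintype Ω] (X : Ω → T → ℝ) (pen : T → ℝ) : Prop :=
  ∀ c : T → ℝ, (∑ ω, Real.exp (⨆ t, (c t + X ω t - pen t))) *
    (∑ ω, Real.exp (-⨆ t, (c t + X ω t))) ≤ (Fintype.card Ω : ℝ) ^ 2

variable [Nonempty T]

lemma sum_exp_iSup_le {Ω : Type*} [Fintype Ω] [Nonempty Ω] (Y : Ω → T → ℝ) (a : T → ℝ)
    {θ A B : ℝ} (h0 : 0 ≤ θ) (h1 : θ ≤ 1)
    (hA : ∑ ω, Real.exp (⨆ t, (Y ω t + a t)) ≤ Real.exp A)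
    (hB : ∑ ω, Real.exp (⨆ t, (Y ω t - a t)) ≤ Real.exp B) :
    ∑ ω, Real.exp (⨆ t, (Y ω t + (2 * θ - 1) * a t)) ≤ Real.exp (θ * A + (1 - θ) * B) := by
  have hpt : ∀ ω, Real.exp (⨆ t, (Y ω t + (2 * θ - 1) * a t)) ≤
      Real.exp (θ * A + (1 - θ) * B) *
        (θ * (Real.exp (⨆ t, (Y ω t + a t)) * Real.exp (-A)) +
          (1 - θ) * (Real.exp (⨆ t, (Y ω t - a t)) * Real.exp (-B))) := by
    intro ω
    set p := ⨆ t, (Y ω t + a t)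
    set q := ⨆ t, (Y ω t - a t)
    have hle : ⨆ t, (Y ω t + (2 * θ - 1) * a t) ≤ θ * p + (1 - θ) * q := by
      refine ciSup_le fun t => ?_
      have hp : Y ω t + a t ≤ p := le_iSup_of_finite (fun t => Y ω t + a t) t
      have hq : Y ω t - a t ≤ q := le_iSup_of_finite (fun t => Y ω t - a t) t
      nlinarith [mul_le_mul_of_nonneg_left hp h0,
        mul_le_mul_of_nonneg_left hq (sub_nonneg.2 h1)]
    have hc := convexOn_exp.2 (Set.mem_univ (p - A)) (Set.mem_univ (q - B)) h0
      (sub_nonneg.2 h1) (by ring)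
    simp only [smul_eq_mul] at hc
    rw [← Real.exp_add, ← Real.exp_add, ← sub_eq_add_neg, ← sub_eq_add_neg]
    calc Real.exp (⨆ t, (Y ω t + (2 * θ - 1) * a t))
        ≤ Real.exp (θ * p + (1 - θ) * q) := Real.exp_le_exp.2 hle
      _ = Real.exp (θ * A + (1 - θ) * B) * Real.exp (θ * (p - A) + (1 - θ) * (q - B)) := by
        rw [← Real.exp_add]; ring_nf
      _ ≤ _ := by gcongr
  refine (Finset.sum_le_sum fun ω _ => hpt ω).trans ?_
  rw [← Finset.mul_sum, Finset.sum_add_distrib, ← Finset.mul_sum, ← Finset.mul_sum,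
    ← Finset.sum_mul, ← Finset.sum_mul]
  have eA : Real.exp A * Real.exp (-A) = 1 := by rw [← Real.exp_add]; simp
  have eB : Real.exp B * Real.exp (-B) = 1 := by rw [← Real.exp_add]; simp
  have hA' := mul_le_mul_of_nonneg_right hA (Real.exp_pos (-A)).le
  have hB' := mul_le_mul_of_nonneg_right hB (Real.exp_pos (-B)).le
  rw [eA] at hA'
  rw [eB] at hB'
  refine mul_le_of_le_one_right (Real.exp_pos _).le ?_
  nlinarith [mul_le_mul_of_nonneg_left hA' h0, mul_le_mul_of_nonneg_left hB' (sub_nonneg.2 h1)]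

lemma InfConv.add_sign {Ω : Type*} [Fintype Ω] [Nonempty Ω] {X : Ω → T → ℝ} {pen : T → ℝ}
    (h : InfConv X pen) (a : T → ℝ) :
    InfConv (fun (ω : Ω × Bool) t => X ω.1 t + (if ω.2 then a t else -a t))
      (fun t => pen t + 2 * a t ^ 2) := by
  intro c
  simp only [Fintype.sum_prod_type, Fintype.sum_bool, if_true, Bool.false_eq_true, if_false,
    Fintype.card_prod, Fintype.card_bool, Finset.sum_add_distrib]
  set N : ℝ := (Fintype.card Ω : ℝ)
  have hN : 0 < N := Nat.cast_pos.2 Fintype.card_pos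
  set U₁ := ∑ ω, Real.exp (-⨆ t, (c t + (X ω t + a t)))
  set U₂ := ∑ ω, Real.exp (-⨆ t, (c t + (X ω t + -a t)))
  have hU₁ : 0 < U₁ := Finset.sum_pos (fun _ _ => Real.exp_pos _) Finset.univ_nonempty
  have hU₂ : 0 < U₂ := Finset.sum_pos (fun _ _ => Real.exp_pos _) Finset.univ_nonempty
  have hN2 : 0 < N ^ 2 := by positivity
  set V₁ := ∑ ω, Real.exp (⨆ t, (c t + (X ω t + a t) - (pen t + 2 * a t ^ 2)))
  set V₂ := ∑ ω, Real.exp (⨆ t, (c t + (X ω t + -a t) - (pen t + 2 * a t ^ 2)))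
  set A := Real.log (N ^ 2 / U₁)
  set B := Real.log (N ^ 2 / U₂)
  have hA : Real.exp A = N ^ 2 / U₁ := Real.exp_log (by positivity)
  have hB : Real.exp B = N ^ 2 / U₂ := Real.exp_log (by positivity)
  have hWA : ∑ ω, Real.exp (⨆ t, ((c t + X ω t - pen t) + a t)) ≤ Real.exp A := by
    rw [hA, le_div_iff₀ hU₁]
    convert h (fun t => c t + a t) using 6 <;> first | rfl | ring1 | (ext; ring1)
  have hWB : ∑ ω, Real.exp (⨆ t, ((c t + X ω t - pen t) - a t)) ≤ Real.exp B := by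
    rw [hB, le_div_iff₀ hU₂]
    convert h (fun t => c t - a t) using 6 <;> first | rfl | ring1 | (ext; ring1)
  have hV : ∀ y θ : ℝ, 0 ≤ θ → θ ≤ 1 →
      ∑ ω, Real.exp (⨆ t, (c t + (X ω t + y * a t) - (pen t + 2 * a t ^ 2))) ≤
        Real.exp ((y - (2 * θ - 1)) ^ 2 / 8 + θ * A + (1 - θ) * B) := by
    intro y θ h0 h1
    rw [add_assoc, Real.exp_add]
    refine le_trans ?_ (mul_le_mul_of_nonneg_left (sum_exp_iSup_le _ a h0 h1 hWA hWB)
      (Real.exp_pos _).le)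
    rw [Finset.mul_sum]
    refine Finset.sum_le_sum fun ω _ => ?_
    rw [← Real.exp_add]
    refine Real.exp_le_exp.2 (ciSup_le fun t => ?_)
    have ht := le_iSup_of_finite
      (fun t => c t + X ω t - pen t + (2 * θ - 1) * a t) t
    have hsq : 0 ≤ ((y - (2 * θ - 1)) - 4 * a t) ^ 2 := sq_nonneg _
    nlinarith
  have h2 := two_point (A := A) (B := B) (V₁ := V₁) (V₂ := V₂)
    (fun θ h0 h1 => by
      convert hV 1 θ h0 h1 using 2
      · simp
      · ring)
    (fun θ h0 h1 => by
      convert hV (-1) θ h0 h1 using 2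
      · simp
      · ring)
  rw [Real.exp_neg, Real.exp_neg, hA, hB, inv_div, inv_div, ← add_div, ← mul_div_assoc,
    div_le_iff₀ hN2] at h2
  push_cast
  linarith [h2]

/-- The value of the signed selection between `p` and `q`: the first bit is a sign, the second one
selects. -/
def signedPick (b : Bool × Bool) (p q : ℝ) : ℝ :=
  (if b.1 then 1 else -1) * (if b.2 then p else q)

lemma InfConv.add_signedPick {Ω : Type*} [Fintype Ω] [Nonempty Ω] {X : Ω → T → ℝ} {pen : T → ℝ}
    (h : InfConv X pen) (p q : T → ℝ) :
    InfConv (fun (ω : (Bool × Bool) × Ω) t => signedPick ω.1 (p t) (q t) + X ω.2 t)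
      (fun t => (p t ^ 2 + q t ^ 2) + pen t) := by
  intro c
  have h2 := ((h.add_sign (fun t => (p t + q t) / 2)).add_sign (fun t => (p t - q t) / 2)) c
  simp only [Fintype.sum_prod_type, Fintype.sum_bool, if_true, Bool.false_eq_true, if_false,
    Fintype.card_prod, Fintype.card_bool, Finset.sum_add_distrib, signedPick] at h2 ⊢
  have e : ∀ t, pen t + 2 * ((p t + q t) / 2) ^ 2 + 2 * ((p t - q t) / 2) ^ 2 =
      p t ^ 2 + q t ^ 2 + pen t := fun t => by ring
  have e1 : ∀ ω t, X ω t + (p t + q t) / 2 + (p t - q t) / 2 = 1 * p t + X ω t :=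
    fun ω t => by ring
  have e2 : ∀ ω t, X ω t + (p t + q t) / 2 + -((p t - q t) / 2) = 1 * q t + X ω t :=
    fun ω t => by ring
  have e3 : ∀ ω t, X ω t + -((p t + q t) / 2) + (p t - q t) / 2 = -1 * q t + X ω t :=
    fun ω t => by ring
  have e4 : ∀ ω t, X ω t + -((p t + q t) / 2) + -((p t - q t) / 2) = -1 * p t + X ω t :=
    fun ω t => by ring
  simp only [e, e1, e2, e3, e4] at h2
  push_cast at h2 ⊢
  refine le_trans (le_of_eq ?_) (h2.trans_eq ?_) <;> ring

lemma infConv_pi_signedPick (n : ℕ) (p q : Fin n → T → ℝ) :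
    InfConv (fun (ω : Fin n → Bool × Bool) t => ∑ i, signedPick (ω i) (p i t) (q i t))
      (fun t => ∑ i, (p i t ^ 2 + q i t ^ 2)) := by
  induction n with
  | zero => intro c; simp [← Real.exp_add]
  | succ n ih =>
    intro c
    have h := (ih (fun i => p i.succ) (fun i => q i.succ)).add_signedPick (p 0) (q 0) c
    simp only [sum_fin_succ_pi, Fin.sum_univ_succ, Fin.cons_zero, Fin.cons_succ,
      Fintype.sum_prod_type (α₁ := Bool × Bool), Fintype.card_prod,
      Fintype.card_fun, Fintype.card_fin, pow_succ] at h ⊢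
    refine h.trans_eq ?_
    push_cast; ring

lemma exp_add_exp_le {x y M m : ℝ} (hx : x ≤ max M m) (hy : y ≤ max M m) (h : x + y ≤ M + m) :
    Real.exp x + Real.exp y ≤ Real.exp M + Real.exp m := by
  wlog hxy : y ≤ x generalizing x y
  · rw [add_comm (Real.exp x)]
    exact this hy hx (by linarith) (by linarith)
  wlog hM : m ≤ M generalizing M m
  · rw [add_comm (Real.exp M)]
    exact this (by rwa [max_comm]) (by rwa [max_comm]) (by linarith) (by linarith)
  rw [max_eq_left hM] at hx hy
  rcases le_total y m with hm | hm
  · gcongr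
  · have h1 : Real.exp (x + (y - m)) ≤ Real.exp M := Real.exp_le_exp.2 (by linarith)
    have h2 : Real.exp (x + (y - m)) = Real.exp x * Real.exp (y - m) := Real.exp_add _ _
    have h3 : Real.exp y = Real.exp m * Real.exp (y - m) := by rw [← Real.exp_add]; ring_nf
    have h4 : Real.exp m ≤ Real.exp x := Real.exp_le_exp.2 (by linarith)
    have h5 : 1 ≤ Real.exp (y - m) := Real.one_le_exp (by linarith)
    nlinarith

/-- One coordinate of the Ledoux–Talagrand contraction principle for the exponential function. -/
lemma exp_iSup_contraction (c u v : T → ℝ) (hv : ∀ t, |v t| ≤ |u t|)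
    (huv : ∀ s t, |v s - v t| ≤ |u s - u t|) :
    Real.exp (⨆ t, (c t + v t)) + Real.exp (⨆ t, (c t - v t)) ≤
      Real.exp (⨆ t, (c t + u t)) + Real.exp (⨆ t, (c t - u t)) := by
  obtain ⟨s, hs⟩ := exists_eq_ciSup_of_finite (f := fun t => c t + v t)
  obtain ⟨r, hr⟩ := exists_eq_ciSup_of_finite (f := fun t => c t - v t)
  have hp := le_iSup_of_finite (fun t => c t + u t)
  have hm := le_iSup_of_finite (fun t => c t - u t)
  rw [← hs, ← hr]
  have hmax : ∀ t, c t + |u t| ≤ max (⨆ t, (c t + u t)) (⨆ t, (c t - u t)) := by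
    intro t
    rcases abs_choice (u t) with h | h <;> rw [h]
    · exact le_max_of_le_left (hp t)
    · exact le_max_of_le_right (by simpa [sub_eq_add_neg] using hm t)
  refine exp_add_exp_le ?_ ?_ ?_
  · linarith [hmax s, hv s, le_abs_self (v s)]
  · linarith [hmax r, hv r, neg_abs_le (v r)]
  · have h1 := (le_abs_self _).trans (huv s r)
    rcases abs_choice (u s - u r) with h | h <;> rw [h] at h1
    · linarith [hp s, hm r]
    · linarith [hp r, hm s]

lemma exp_iSup_add_le (c u v : T → ℝ) :
    Real.exp (⨆ t, (c t + (u t + v t))) ≤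
      (Real.exp (⨆ t, (c t + 2 * u t)) + Real.exp (⨆ t, (c t + 2 * v t))) / 2 := by
  set x := ⨆ t, (c t + 2 * u t)
  set y := ⨆ t, (c t + 2 * v t)
  have h : ⨆ t, (c t + (u t + v t)) ≤ x / 2 + y / 2 := by
    refine ciSup_le fun t => ?_
    have h1 : c t + 2 * u t ≤ x := le_iSup_of_finite (fun t => c t + 2 * u t) t
    have h2 : c t + 2 * v t ≤ y := le_iSup_of_finite (fun t => c t + 2 * v t) t
    linarith
  refine (Real.exp_le_exp.2 h).trans ?_
  have e1 : Real.exp x = Real.exp (x / 2) ^ 2 := by rw [← Real.exp_nat_mul]; ring_nf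
  have e2 : Real.exp y = Real.exp (y / 2) ^ 2 := by rw [← Real.exp_nat_mul]; ring_nf
  rw [e1, e2, Real.exp_add]
  nlinarith [sq_nonneg (Real.exp (x / 2) - Real.exp (y / 2))]

/-- A nonlinear penalty: `w` is `2 (L - 1)`-Lipschitz, vanishes at zero, and dominates the square
function on `[-1/2, 1/2]`. -/
structure IsPenalty (w : ℝ → ℝ) (L l : ℝ) : Prop where
  one_le : 1 ≤ L
  pos : 0 < l
  zero : w 0 = 0
  lip : ∀ u v, |w u - w v| ≤ 2 * (L - 1) * |u - v|
  sq_le : ∀ u, |u| ≤ 1 / 2 → 16 * l * L ^ 2 * u ^ 2 ≤ w u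

/-- The difference between selected and unselected value, penalized at the latter. -/
def swapDiff (w : ℝ → ℝ) (b : Bool × Bool) (p q : ℝ) : ℝ :=
  if b.2 then p - q - w q else q - p - w p

lemma IsPenalty.sum_exp_swapDiff_le {w : ℝ → ℝ} {L l : ℝ} (hw : IsPenalty w L l)
    (p q : T → ℝ) (hp : ∀ t, |p t| ≤ 1 / 2) (hq : ∀ t, |q t| ≤ 1 / 2) (c : T → ℝ) :
    ∑ b, Real.exp (⨆ t, (c t + 2 * l * swapDiff w b (p t) (q t))) ≤
      ∑ b, Real.exp (⨆ t, (c t + (4 * l * L * signedPick b (p t) (q t) -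
        ((4 * l * L * p t) ^ 2 + (4 * l * L * q t) ^ 2)))) := by
  obtain ⟨hL, hl, h0, hlip, hsq⟩ := hw
  set ψ : ℝ → ℝ := fun u => u + w u / 2 with hψ
  set d : T → ℝ := fun t => c t - ((4 * l * L * p t) ^ 2 + (4 * l * L * q t) ^ 2) with hd
  have hψlip : ∀ u v, |ψ u - ψ v| ≤ L * |u - v| := by
    intro u v
    have e : ψ u - ψ v = (u - v) + (w u - w v) / 2 := by simp only [hψ]; ring
    have h1 := abs_add_le (u - v) ((w u - w v) / 2)
    rw [abs_div, abs_two] at h1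
    rw [e]
    nlinarith [hlip u v]
  have hcontr : ∀ r : T → ℝ,
      Real.exp (⨆ t, (d t + 4 * l * ψ (r t))) + Real.exp (⨆ t, (d t - 4 * l * ψ (r t))) ≤
      Real.exp (⨆ t, (d t + 4 * l * L * r t)) + Real.exp (⨆ t, (d t - 4 * l * L * r t)) := by
    intro r
    have hkey : ∀ u v, |4 * l * ψ u - 4 * l * ψ v| ≤ |4 * l * L * u - 4 * l * L * v| := by
      intro u v
      rw [← mul_sub, ← mul_sub, abs_mul (4 * l), abs_mul (4 * l * L),
        abs_of_pos (by positivity : 0 < 4 * l), abs_of_pos (by positivity : 0 < 4 * l * L),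
        mul_assoc (4 * l)]
      exact mul_le_mul_of_nonneg_left (hψlip u v) (by positivity)
    refine exp_iSup_contraction d _ _ (fun t => ?_) (fun s t => hkey _ _)
    simpa [hψ, h0] using hkey (r t) 0
  have hstep : ∀ r s : T → ℝ, (∀ t, c t + 2 * l * (r t - s t - w (s t)) ≤
        d t + (2 * l * ψ (r t) + -(2 * l * ψ (s t)))) →
      Real.exp (⨆ t, (c t + 2 * l * (r t - s t - w (s t)))) ≤
        (Real.exp (⨆ t, (d t + 4 * l * ψ (r t))) +
          Real.exp (⨆ t, (d t - 4 * l * ψ (s t)))) / 2 := by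
    intro r s hrs
    refine (Real.exp_le_exp.2 (ciSup_mono (Set.finite_range _).bddAbove hrs)).trans
      ((exp_iSup_add_le _ _ _).trans_eq ?_)
    simp only [mul_neg, ← mul_assoc, ← sub_eq_add_neg]
    norm_num
  have hpq := hstep p q (fun t => by
    simp only [hd, hψ]; nlinarith [hsq _ (hp t), hsq _ (hq t)])
  have hqp := hstep q p (fun t => by
    simp only [hd, hψ]; nlinarith [hsq _ (hp t), hsq _ (hq t)])
  have hcp := hcontr p
  have hcq := hcontr q
  have e1 : ∀ t r, c t + (4 * l * L * (1 * r) - ((4 * l * L * p t) ^ 2 + (4 * l * L * q t) ^ 2)) =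
      d t + 4 * l * L * r := fun t r => by simp only [hd]; ring
  have e2 : ∀ t r, c t + (4 * l * L * (-1 * r) - ((4 * l * L * p t) ^ 2 + (4 * l * L * q t) ^ 2)) =
      d t - 4 * l * L * r := fun t r => by simp only [hd]; ring
  simp only [Fintype.sum_prod_type, Fintype.sum_bool, swapDiff, signedPick, if_true,
    Bool.false_eq_true, if_false, e1, e2]
  linarith

/-- The conditional form of the symmetrized concentration inequality, on the discrete cube. -/
lemma IsPenalty.sum_exp_le {w : ℝ → ℝ} {L l : ℝ} (hw : IsPenalty w L l) (n : ℕ)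
    (p q : Fin n → T → ℝ) (hp : ∀ i t, |p i t| ≤ 1 / 2) (hq : ∀ i t, |q i t| ≤ 1 / 2) :
    ∑ ω : Fin n → Bool × Bool,
      Real.exp (l * ((⨆ t, ∑ i, swapDiff w (ω i) (p i t) (q i t)) -
        2 * L * ⨆ t, ∑ i, signedPick (ω i) (p i t) (q i t))) ≤ 4 ^ n := by
  have hl := hw.pos
  have hL := hw.one_le
  have scale : ∀ k : ℝ, 0 ≤ k → ∀ f : T → ℝ, ⨆ t, (0 + k * f t) = k * ⨆ t, f t :=
    fun k hk f => by simp only [zero_add]; exact (Real.mul_iSup_of_nonneg hk f).symm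
  set D : (Fin n → Bool × Bool) → ℝ := fun ω => ⨆ t, ∑ i, swapDiff w (ω i) (p i t) (q i t)
  set R : (Fin n → Bool × Bool) → ℝ := fun ω => ⨆ t, ∑ i, signedPick (ω i) (p i t) (q i t)
  have hD := sum_pi_exp_iSup_le n (fun i b t => 2 * l * swapDiff w b (p i t) (q i t))
    (fun i b t => 4 * l * L * signedPick b (p i t) (q i t) -
        ((4 * l * L * p i t) ^ 2 + (4 * l * L * q i t) ^ 2))
    (fun i c => hw.sum_exp_swapDiff_le (p i) (q i) (hp i) (hq i) c) 0
  have hR := infConv_pi_signedPick n (fun i t => 4 * l * L * p i t)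
    (fun i t => 4 * l * L * q i t) 0
  have hpick : ∀ (b : Bool × Bool) (k x y : ℝ),
      signedPick b (k * x) (k * y) = k * signedPick b x y := by
    intro b k x y
    unfold signedPick
    split_ifs <;> ring
  simp only [Pi.zero_apply, hpick, ← Finset.mul_sum, Finset.sum_sub_distrib] at hD hR
  simp only [scale _ (by positivity : 0 ≤ 2 * l), scale _ (by positivity : 0 ≤ 4 * l * L),
    ← add_sub_assoc] at hD hR
  have hcard : (Fintype.card (Fin n → Bool × Bool) : ℝ) = 4 ^ n := by simp
  rw [hcard] at hR
  have hprod : (∑ ω, Real.exp (2 * l * D ω)) * (∑ ω, Real.exp (-(4 * l * L * R ω))) ≤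
      (4 ^ n) ^ 2 :=
    (mul_le_mul_of_nonneg_right hD (Finset.sum_nonneg fun _ _ => (Real.exp_pos _).le)).trans hR
  have hcs := Finset.sum_mul_sq_le_sq_mul_sq Finset.univ (fun ω => Real.exp (l * D ω))
    (fun ω => Real.exp (-(2 * l * L * R ω)))
  have e1 : ∀ ω, Real.exp (l * D ω) ^ 2 = Real.exp (2 * l * D ω) := fun ω => by
    rw [← Real.exp_nat_mul]; push_cast; ring_nf
  have e2 : ∀ ω, Real.exp (-(2 * l * L * R ω)) ^ 2 = Real.exp (-(4 * l * L * R ω)) := fun ω => by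
    rw [← Real.exp_nat_mul]; push_cast; ring_nf
  simp only [← Real.exp_add, e1, e2] at hcs
  have e3 : ∀ ω, l * (D ω - 2 * L * R ω) = l * D ω + -(2 * l * L * R ω) := fun ω => by ring
  simp only [D, R] at e3 hcs hprod
  simp only [e3]
  exact (sq_le_sq₀ (Finset.sum_nonneg fun _ _ => (Real.exp_pos _).le) (by positivity)).1
    (hcs.trans hprod)

end

/-- The sign `±1` encoded by a Boolean. -/
def boolSign (b : Bool) : ℝ := if b then 1 else -1

instance : IsProbabilityMeasure radMeasure :=
  ⟨by simp [radMeasure, ENNReal.inv_two_add_inv_two]⟩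

lemma radMeasure_eq_sum :
    radMeasure = ∑ b : Bool × Bool, (4 : ENNReal)⁻¹ • Measure.dirac (boolSign b.1) := by
  have h : (4 : ENNReal)⁻¹ + 4⁻¹ = 2⁻¹ := by
    rw [← ENNReal.toReal_eq_toReal_iff' (by simp) (by simp), ENNReal.toReal_add (by simp) (by simp)]
    norm_num
  simp [radMeasure, Fintype.sum_prod_type, boolSign, ← add_smul, h]

lemma pi_radMeasure_eq_sum (n : ℕ) :
    (Measure.pi fun _ : Fin n => radMeasure) =
      ∑ ω : Fin n → Bool × Bool,
        (4 : ENNReal)⁻¹ ^ n • Measure.dirac (fun i => boolSign (ω i).1) := by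
  classical
  refine Measure.pi_eq fun s hs => ?_
  simp only [radMeasure_eq_sum, Measure.coe_finsetSum, Finset.sum_apply, Measure.smul_apply,
    smul_eq_mul, Fintype.prod_sum]
  refine Finset.sum_congr rfl fun ω _ => ?_
  rw [Finset.prod_mul_distrib, Finset.prod_const, Finset.card_univ, Fintype.card_fin,
    Measure.dirac_apply' _ (MeasurableSet.univ_pi hs)]
  simp only [Measure.dirac_apply' _ (hs _)]
  congr 1
  simp only [Set.indicator_apply, Pi.one_apply, Finset.prod_ite_zero, Set.mem_univ_pi,
    Finset.mem_univ, forall_true_left, Finset.prod_const_one]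

lemma lintegral_pi_radMeasure (n : ℕ) (g : (Fin n → ℝ) → ENNReal) :
    ∫⁻ e, g e ∂(Measure.pi fun _ : Fin n => radMeasure) =
      (4 : ENNReal)⁻¹ ^ n * ∑ ω : Fin n → Bool × Bool, g fun i => boolSign (ω i).1 := by
  rw [pi_radMeasure_eq_sum, lintegral_finsetSum_measure, Finset.mul_sum]
  simp only [lintegral_smul_measure, lintegral_dirac, smul_eq_mul]

lemma IsPenalty.measurable {w : ℝ → ℝ} {L l : ℝ} (hw : IsPenalty w L l) : Measurable w :=
  (LipschitzWith.of_dist_le_mul (K := ⟨2 * (L - 1), by linarith [hw.one_le]⟩)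
    fun u v => by rw [Real.dist_eq, Real.dist_eq]; exact hw.lip u v).continuous.measurable

section

variable {S : Type*} [MeasurableSpace S] {P : Measure S} [IsProbabilityMeasure P]
  {T : Type*} [Finite T] [Nonempty T] {w : ℝ → ℝ} {L l : ℝ} {a : T → S → ℝ}

lemma IsPenalty.lintegral_pi_prod_le (hw : IsPenalty w L l) (n : ℕ)
    (ham : ∀ t, Measurable (a t)) (hab : ∀ t s, |a t s| ≤ 1 / 2) :
    ∫⁻ Z, ∑ ω : Fin n → Bool × Bool, ENNReal.ofReal (Real.exp (l *
      ((⨆ t, ∑ i, (a t (Z i).1 - a t (Z i).2 - w (a t (Z i).2))) -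
        2 * L * ⨆ t, ∑ i, boolSign (ω i).1 * a t (Z i).1)))
      ∂(Measure.pi fun _ : Fin n => P.prod P) ≤ 4 ^ n := by
  have hwm := hw.measurable
  set Φ : (Fin n → S × S) → (Fin n → Bool × Bool) → ENNReal := fun Z ω =>
    ENNReal.ofReal (Real.exp (l *
      ((⨆ t, ∑ i, (a t (Z i).1 - a t (Z i).2 - w (a t (Z i).2))) -
        2 * L * ⨆ t, ∑ i, boolSign (ω i).1 * a t (Z i).1)))
  have hΦ : ∀ ω, Measurable fun Z => Φ Z ω := fun ω => by
    have h1 : Measurable fun Z : Fin n → S × S =>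
        ⨆ t, ∑ i, (a t (Z i).1 - a t (Z i).2 - w (a t (Z i).2)) :=
      Measurable.iSup fun t => by fun_prop
    have h2 : Measurable fun Z : Fin n → S × S => ⨆ t, ∑ i, boolSign (ω i).1 * a t (Z i).1 :=
      Measurable.iSup fun t => by fun_prop
    fun_prop
  set G : Bool → S × S → S × S := fun b z => if b then z else z.swap
  have hG : ∀ b, MeasurePreserving (G b) (P.prod P) (P.prod P) := by
    intro b
    cases b
    · exact Measure.measurePreserving_swap
    · exact MeasurePreserving.id _
  set sw : (Fin n → Bool × Bool) → (Fin n → S × S) → (Fin n → S × S) :=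
    fun ω Z i => G (ω i).2 (Z i)
  have hsw : ∀ ω, MeasurePreserving (sw ω) (Measure.pi fun _ : Fin n => P.prod P)
      (Measure.pi fun _ : Fin n => P.prod P) :=
    fun ω => measurePreserving_pi _ _ fun i => hG (ω i).2
  calc ∫⁻ Z, ∑ ω, Φ Z ω ∂(Measure.pi fun _ : Fin n => P.prod P)
      = ∫⁻ Z, ∑ ω, Φ (sw ω Z) ω ∂(Measure.pi fun _ : Fin n => P.prod P) := by
        rw [lintegral_finsetSum _ fun ω _ => hΦ ω,
          lintegral_finsetSum (f := fun ω Z => Φ (sw ω Z) ω) _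
            fun ω _ => (hΦ ω).comp (hsw ω).measurable]
        exact Finset.sum_congr rfl fun ω _ => ((hsw ω).lintegral_comp (hΦ ω)).symm
    _ ≤ ∫⁻ Z, 4 ^ n ∂(Measure.pi fun _ : Fin n => P.prod P) := by
        refine lintegral_mono fun Z => ?_
        have h := hw.sum_exp_le n (fun i t => a t (Z i).1) (fun i t => a t (Z i).2)
          (fun i t => hab _ _) (fun i t => hab _ _)
        rw [← ENNReal.ofReal_sum_of_nonneg fun _ _ => (Real.exp_pos _).le]
        refine (ENNReal.ofReal_le_ofReal (le_trans (le_of_eq ?_) h)).trans_eq (by norm_num)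
        refine Finset.sum_congr rfl fun ω _ => ?_
        congr 6
        · ext t; refine Finset.sum_congr rfl fun i _ => ?_
          simp only [sw, G, swapDiff]; split_ifs <;> rfl
        · ext t; refine Finset.sum_congr rfl fun i _ => ?_
          simp only [sw, G, signedPick, boolSign]; split_ifs <;> rfl
    _ = 4 ^ n := by simp

lemma IsPenalty.integrable_comp (hw : IsPenalty w L l) {f : S → ℝ}
    (hfm : Measurable f) (hfb : ∀ s, |f s| ≤ 1 / 2) : Integrable (fun s => w (f s)) P := by
  refine Integrable.of_bound (hw.measurable.comp hfm).aestronglyMeasurable (2 * (L - 1) * (1 / 2))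
    (ae_of_all _ fun s => ?_)
  have h := hw.lip (f s) 0
  rw [hw.zero, sub_zero, sub_zero] at h
  exact h.trans (mul_le_mul_of_nonneg_left (hfb s) (by linarith [hw.one_le]))

/-- Jensen's inequality for an independent copy of the sample. -/
lemma IsPenalty.exp_le_lintegral (hw : IsPenalty w L l) {n : ℕ}
    (ham : ∀ t, Measurable (a t)) (hab : ∀ t s, |a t s| ≤ 1 / 2) (X : Fin n → S) (r : ℝ) :
    ENNReal.ofReal (Real.exp (l *
      ((⨆ t, ∑ i, (a t (X i) - ∫ s, (a t s + w (a t s)) ∂P)) - r))) ≤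
    ∫⁻ Y, ENNReal.ofReal (Real.exp (l *
      ((⨆ t, ∑ i, (a t (X i) - a t (Y i) - w (a t (Y i)))) - r)))
      ∂(Measure.pi fun _ : Fin n => P) := by
  have hwm := hw.measurable
  obtain ⟨t, ht⟩ := exists_eq_ciSup_of_finite
    (f := fun t => ∑ i, (a t (X i) - ∫ s, (a t s + w (a t s)) ∂P))
  rw [← ht]
  set g : S → ℝ := fun s => a t s + w (a t s)
  have hg : Integrable g P :=
    (Integrable.of_bound (ham t).aestronglyMeasurable _ (ae_of_all _ (hab t))).add
      (hw.integrable_comp (ham t) (hab t))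
  have hgb : ∀ s, |g s| ≤ L := fun s => by
    have h := hw.lip (a t s) 0
    rw [hw.zero, sub_zero, sub_zero] at h
    have h1 := abs_add_le (a t s) (w (a t s))
    nlinarith [hab t s, hw.one_le]
  have hgi : ∀ i : Fin n, Integrable (fun Y : Fin n → S => a t (X i) - g (Y i))
      (Measure.pi fun _ : Fin n => P) :=
    fun i => (integrable_const _).sub (integrable_comp_eval (μ := fun _ : Fin n => P) (i := i) hg)
  set f : (Fin n → S) → ℝ := fun Y => l * (∑ i, (a t (X i) - g (Y i)) - r)
  have hfm : Measurable f := by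
    have := ham t
    fun_prop
  have hfi : Integrable f (Measure.pi fun _ : Fin n => P) :=
    ((integrable_finsetSum _ fun i _ => hgi i).sub (integrable_const _)).const_mul _
  have hfint : ∫ Y, f Y ∂(Measure.pi fun _ : Fin n => P) =
      l * (∑ i, (a t (X i) - ∫ s, g s ∂P) - r) := by
    simp only [f]
    rw [integral_const_mul, integral_sub (integrable_finsetSum _ fun i _ => hgi i)
      (integrable_const _), integral_finsetSum _ fun i _ => hgi i]
    congr 2
    · refine Finset.sum_congr rfl fun i _ => ?_
      rw [integral_sub (integrable_const _)
        (integrable_comp_eval (μ := fun _ : Fin n => P) (i := i) hg),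
        integral_comp_eval (μ := fun _ : Fin n => P) (i := i) hg.aestronglyMeasurable]
      simp
    · simp
  have hfb : ∀ Y, f Y ≤ l * (∑ i, (a t (X i) + L) - r) := fun Y => by
    refine mul_le_mul_of_nonneg_left (sub_le_sub_right (Finset.sum_le_sum fun i _ => ?_) _)
      hw.pos.le
    linarith [neg_abs_le (g (Y i)), hgb (Y i)]
  have hexp : Integrable (fun Y => Real.exp (f Y)) (Measure.pi fun _ : Fin n => P) :=
    Integrable.of_bound (Real.measurable_exp.comp hfm).aestronglyMeasurable _
      (ae_of_all _ fun Y => by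
        rw [Real.norm_eq_abs, Real.abs_exp]
        exact Real.exp_le_exp.2 (hfb Y))
  have hJ := convexOn_exp.map_integral_le (μ := Measure.pi fun _ : Fin n => P) (f := f)
    Real.continuous_exp.continuousOn isClosed_univ (by simp) hfi hexp
  rw [hfint] at hJ
  refine (ENNReal.ofReal_le_ofReal hJ).trans ?_
  rw [ofReal_integral_eq_lintegral_ofReal hexp (ae_of_all _ fun _ => (Real.exp_pos _).le)]
  refine lintegral_mono fun Y => ENNReal.ofReal_le_ofReal (Real.exp_le_exp.2
    (mul_le_mul_of_nonneg_left (sub_le_sub_right ?_ _) hw.pos.le))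
  refine (le_of_eq ?_).trans
    (le_iSup_of_finite (fun t => ∑ i, (a t (X i) - a t (Y i) - w (a t (Y i)))) t)
  simp only [g, sub_sub]

lemma lintegral_lintegral_pi {n : ℕ} {F : (Fin n → S) × (Fin n → S) → ENNReal}
    (hF : Measurable F) :
    ∫⁻ X, ∫⁻ Y, F (X, Y) ∂(Measure.pi fun _ : Fin n => P) ∂(Measure.pi fun _ : Fin n => P) =
      ∫⁻ Z, F (fun i => (Z i).1, fun i => (Z i).2) ∂(Measure.pi fun _ : Fin n => P.prod P) := by
  rw [← lintegral_prod F hF.aemeasurable]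
  exact ((measurePreserving_arrowProdEquivProdArrow S S (Fin n) (fun _ => P)
    (fun _ => P)).lintegral_comp hF).symm

lemma IsPenalty.lintegral_exp_le (hw : IsPenalty w L l) (n : ℕ)
    (ham : ∀ t, Measurable (a t)) (hab : ∀ t s, |a t s| ≤ 1 / 2) :
    ∫⁻ X, ∑ ω : Fin n → Bool × Bool, ENNReal.ofReal (Real.exp (l *
      ((⨆ t, ∑ i, (a t (X i) - ∫ s, (a t s + w (a t s)) ∂P)) -
        2 * L * ⨆ t, ∑ i, boolSign (ω i).1 * a t (X i))))
      ∂(Measure.pi fun _ : Fin n => P) ≤ 4 ^ n := by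
  have hwm := hw.measurable
  have hΦ : ∀ ω : Fin n → Bool × Bool, Measurable fun Z : (Fin n → S) × (Fin n → S) =>
      ENNReal.ofReal (Real.exp (l *
        ((⨆ t, ∑ i, (a t (Z.1 i) - a t (Z.2 i) - w (a t (Z.2 i)))) -
          2 * L * ⨆ t, ∑ i, boolSign (ω i).1 * a t (Z.1 i)))) := fun ω => by
    have h1 : Measurable fun Z : (Fin n → S) × (Fin n → S) =>
        ⨆ t, ∑ i, (a t (Z.1 i) - a t (Z.2 i) - w (a t (Z.2 i))) :=
      Measurable.iSup fun t => by fun_prop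
    have h2 : Measurable fun Z : (Fin n → S) × (Fin n → S) =>
        ⨆ t, ∑ i, boolSign (ω i).1 * a t (Z.1 i) :=
      Measurable.iSup fun t => by fun_prop
    fun_prop
  refine le_trans (lintegral_mono fun X => ?_)
    ((lintegral_lintegral_pi (Finset.measurable_sum Finset.univ fun ω _ => hΦ ω)).trans_le
      (hw.lintegral_pi_prod_le n ham hab))
  refine (Finset.sum_le_sum fun ω _ => hw.exp_le_lintegral ham hab X _).trans_eq
    (lintegral_finsetSum _ fun ω _ => ?_).symm
  have h := (hΦ ω).comp (measurable_prodMk_left (x := X))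
  simpa only [Function.comp_def] using h

lemma IsPenalty.measure_le (hw : IsPenalty w L l) (n : ℕ)
    (ham : ∀ t, Measurable (a t)) (hab : ∀ t s, |a t s| ≤ 1 / 2) (B : ℝ) :
    (Measure.pi fun _ : Fin n => P).prod (Measure.pi fun _ : Fin n => radMeasure)
      {ω | 2 * L * (⨆ t, ∑ i, ω.2 i * a t (ω.1 i)) + B ≤
        ⨆ t, ∑ i, (a t (ω.1 i) - ∫ s, (a t s + w (a t s)) ∂P)} ≤
      ENNReal.ofReal (Real.exp (-(l * B))) := by
  set g : (Fin n → S) × (Fin n → ℝ) → ENNReal := fun z => ENNReal.ofReal (Real.exp (l *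
    ((⨆ t, ∑ i, (a t (z.1 i) - ∫ s, (a t s + w (a t s)) ∂P)) -
      2 * L * ⨆ t, ∑ i, z.2 i * a t (z.1 i))))
  have hg : Measurable g := by
    have h1 : Measurable fun z : (Fin n → S) × (Fin n → ℝ) =>
        ⨆ t, ∑ i, (a t (z.1 i) - ∫ s, (a t s + w (a t s)) ∂P) :=
      Measurable.iSup fun t => by fun_prop
    have h2 : Measurable fun z : (Fin n → S) × (Fin n → ℝ) => ⨆ t, ∑ i, z.2 i * a t (z.1 i) :=
      Measurable.iSup fun t => by fun_prop
    fun_prop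
  have hle_one : ∫⁻ z, g z
      ∂(Measure.pi fun _ : Fin n => P).prod (Measure.pi fun _ : Fin n => radMeasure) ≤ 1 := by
    rw [lintegral_prod _ hg.aemeasurable]
    simp only [lintegral_pi_radMeasure]
    rw [lintegral_const_mul' _ _ (by finiteness)]
    refine (mul_le_mul_right (hw.lintegral_exp_le n ham hab) _).trans_eq ?_
    rw [← mul_pow, ENNReal.inv_mul_cancel (by norm_num) (by norm_num), one_pow]
  have hsub : {ω : (Fin n → S) × (Fin n → ℝ) |
      2 * L * (⨆ t, ∑ i, ω.2 i * a t (ω.1 i)) + B ≤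
        ⨆ t, ∑ i, (a t (ω.1 i) - ∫ s, (a t s + w (a t s)) ∂P)} ⊆
      {z | ENNReal.ofReal (Real.exp (l * B)) ≤ g z} := fun z hz =>
    ENNReal.ofReal_le_ofReal (Real.exp_le_exp.2
      (mul_le_mul_of_nonneg_left (le_sub_iff_add_le'.2 hz) hw.pos.le))
  refine (measure_mono hsub).trans ((meas_ge_le_lintegral_div hg.aemeasurable
    (by simp [Real.exp_pos]) (by simp)).trans ?_)
  refine (ENNReal.div_le_div_right hle_one _).trans_eq ?_
  rw [one_div, ← ENNReal.ofReal_inv_of_pos (Real.exp_pos _), Real.exp_neg]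

end

/-- A multiple of the Huber function: `2 m u ^ 2` for `|u| ≤ 1/4`, continued linearly. -/
def huberPenalty (m u : ℝ) : ℝ :=
  2 * m * (2 * |u| * min |u| (1 / 4) - min |u| (1 / 4) ^ 2)

lemma huberPenalty_le {m : ℝ} (hm : 0 ≤ m) (u : ℝ) : huberPenalty m u ≤ 2 * m * u ^ 2 := by
  refine mul_le_mul_of_nonneg_left ?_ (by positivity)
  nlinarith [sq_nonneg (|u| - min |u| (1 / 4)), sq_abs u]

lemma isPenalty_huberPenalty {m : ℝ} (hm : 0 < m) :
    IsPenalty (huberPenalty m) (1 + m / 2) (3 * m / (32 * (1 + m / 2) ^ 2)) where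
  one_le := by linarith
  pos := by positivity
  zero := by simp [huberPenalty]
  lip u v := by
    have key : ∀ x y : ℝ, 0 ≤ x → 0 ≤ y →
        (2 * x * min x (1 / 4) - min x (1 / 4) ^ 2) - (2 * y * min y (1 / 4) - min y (1 / 4) ^ 2) ≤
          1 / 2 * |x - y| := by
      intro x y hx hy
      rcases abs_cases (x - y) with ⟨h, h'⟩ | ⟨h, h'⟩ <;> rw [h] <;>
      rcases min_cases x (1 / 4) with ⟨h1, h1'⟩ | ⟨h1, h1'⟩ <;> rw [h1] <;>
      rcases min_cases y (1 / 4) with ⟨h2, h2'⟩ | ⟨h2, h2'⟩ <;> rw [h2] <;>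
      nlinarith
    have h1 := key |u| |v| (abs_nonneg _) (abs_nonneg _)
    have h2 := key |v| |u| (abs_nonneg _) (abs_nonneg _)
    rw [abs_sub_comm |v|] at h2
    have h3 := abs_abs_sub_abs_le_abs_sub u v
    have h4 := abs_sub_le_iff.2 ⟨h1.trans (mul_le_mul_of_nonneg_left h3 (by norm_num)),
      h2.trans (mul_le_mul_of_nonneg_left h3 (by norm_num))⟩
    simp only [huberPenalty]
    rw [← mul_sub, abs_mul, abs_of_pos (by positivity : 0 < 2 * m)]
    calc _ ≤ 2 * m * (1 / 2 * |u - v|) := mul_le_mul_of_nonneg_left h4 (by positivity)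
      _ = _ := by ring
  sq_le u hu := by
    have h : 16 * (3 * m / (32 * (1 + m / 2) ^ 2)) * (1 + m / 2) ^ 2 = 2 * m * (3 / 4) := by
      field_simp
      norm_num
    rw [h, mul_assoc, huberPenalty]
    refine mul_le_mul_of_nonneg_left ?_ (by positivity)
    rw [← sq_abs u]
    have := abs_nonneg u
    rcases min_cases |u| (1 / 4) with ⟨h1, h1'⟩ | ⟨h1, h1'⟩ <;> rw [h1] <;> nlinarith

/-- Optimization of the free parameter in the exponential bound. -/
lemma exists_huberPenalty_param {t V : ℝ} (ht : 0 < t) (hV : 0 ≤ V) :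
    ∃ m : ℝ, 0 < m ∧ m ≤ 2 ∧ 2 * m * V + t / (3 * m / (32 * (1 + m / 2) ^ 2)) ≤
      10 * √(t * V) + 22 * t := by
  set r := √(V / t)
  have hr : 0 ≤ r := Real.sqrt_nonneg _
  have hV' : V = r ^ 2 * t := by
    rw [Real.sq_sqrt (by positivity)]
    field_simp
  have hs : √(t * V) = r * t := by
    rw [hV', show t * (r ^ 2 * t) = (r * t) ^ 2 by ring, Real.sqrt_sq (by positivity)]
  refine ⟨2 / (1 + r), by positivity, ?_, ?_⟩
  · rw [div_le_iff₀ (by positivity)]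
    linarith
  · rw [hs]
    have h : 2 * (2 / (1 + r)) * V + t / (3 * (2 / (1 + r)) / (32 * (1 + 2 / (1 + r) / 2) ^ 2)) =
        t * ((4 * r ^ 2 + 16 / 3 * (2 + r) ^ 2) / (1 + r)) := by
      rw [hV']
      field_simp
      ring
    have h2 : (4 * r ^ 2 + 16 / 3 * (2 + r) ^ 2) / (1 + r) ≤ 10 * r + 22 := by
      rw [div_le_iff₀ (by positivity)]
      nlinarith
    rw [h]
    nlinarith [mul_le_mul_of_nonneg_left h2 ht.le]

section

variable {S : Type*} [MeasurableSpace S] {P : Measure S} [IsProbabilityMeasure P]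

lemma measure_finite_le {T : Type*} [Finite T] [Nonempty T] {a : T → S → ℝ} (n : ℕ)
    (ham : ∀ t, Measurable (a t)) (hab : ∀ t s, |a t s| ≤ 1 / 2)
    (hneg : ∀ t, ∃ t', a t' = -a t) {V : ℝ} (hV : ∀ t, n * ∫ s, a t s ^ 2 ∂P ≤ V)
    {x δ : ℝ} (hx : 0 < x) (hδ : 0 ≤ δ) :
    (Measure.pi fun _ : Fin n => P).prod (Measure.pi fun _ : Fin n => radMeasure)
      {ω | 6 * (⨆ t, ∑ i, ω.2 i * a t (ω.1 i)) + 10 * √(x * V) + 22 * x - δ ≤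
        ⨆ t, ∑ i, (a t (ω.1 i) - ∫ s, a t s ∂P)} ≤
      ENNReal.ofReal (Real.exp (δ - x)) := by
  have hV0 : 0 ≤ V := by
    obtain ⟨t⟩ := ‹Nonempty T›
    exact (mul_nonneg n.cast_nonneg (integral_nonneg fun s => sq_nonneg _)).trans (hV t)
  obtain ⟨m, hm, hm2, hmV⟩ := exists_huberPenalty_param hx hV0
  have hw := isPenalty_huberPenalty hm
  set l := 3 * m / (32 * (1 + m / 2) ^ 2)
  have hl : 0 < l := hw.pos
  have hl1 : l ≤ 1 := by
    rw [div_le_one (by positivity)]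
    nlinarith
  have hai : ∀ t, Integrable (a t) P := fun t =>
    Integrable.of_bound (ham t).aestronglyMeasurable _ (ae_of_all _ (hab t))
  have hwi := fun t => hw.integrable_comp (P := P) (ham t) (hab t)
  have hsq : ∀ t, Integrable (fun s => a t s ^ 2) P := fun t =>
    Integrable.of_bound ((ham t).pow_const 2).aestronglyMeasurable 1 (ae_of_all _ fun s => by
      rw [Real.norm_eq_abs, abs_pow]
      nlinarith [hab t s, abs_nonneg (a t s)])
  have hpen : ∀ t, n * ∫ s, huberPenalty m (a t s) ∂P ≤ 2 * m * V := fun t => by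
    have h : ∫ s, huberPenalty m (a t s) ∂P ≤ ∫ s, 2 * m * a t s ^ 2 ∂P :=
      integral_mono (hwi t) ((hsq t).const_mul _) fun s => huberPenalty_le hm.le _
    rw [integral_const_mul] at h
    calc _ ≤ n * (2 * m * ∫ s, a t s ^ 2 ∂P) := mul_le_mul_of_nonneg_left h n.cast_nonneg
      _ = 2 * m * (n * ∫ s, a t s ^ 2 ∂P) := by ring
      _ ≤ _ := mul_le_mul_of_nonneg_left (hV t) (by positivity)
  refine (measure_mono ?_).trans ((hw.measure_le n ham hab
    (10 * √(x * V) + 22 * x - δ - 2 * m * V)).trans (ENNReal.ofReal_le_ofReal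
      (Real.exp_le_exp.2 ?_)))
  · intro ω hω
    simp only [Set.mem_ofPred_eq] at hω ⊢
    have hR : 0 ≤ ⨆ t, ∑ i, ω.2 i * a t (ω.1 i) := by
      obtain ⟨t⟩ := ‹Nonempty T›
      obtain ⟨t', ht'⟩ := hneg t
      have h1 := le_iSup_of_finite (fun t => ∑ i, ω.2 i * a t (ω.1 i)) t
      have h2 := le_iSup_of_finite (fun t => ∑ i, ω.2 i * a t (ω.1 i)) t'
      simp only [ht', Pi.neg_apply, mul_neg, Finset.sum_neg_distrib] at h1 h2
      linarith
    have hZ : ⨆ t, ∑ i, (a t (ω.1 i) - ∫ s, a t s ∂P) ≤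
        (⨆ t, ∑ i, (a t (ω.1 i) - ∫ s, (a t s + huberPenalty m (a t s)) ∂P)) + 2 * m * V := by
      refine ciSup_le fun t => ?_
      have h := le_iSup_of_finite
        (fun t => ∑ i, (a t (ω.1 i) - ∫ s, (a t s + huberPenalty m (a t s)) ∂P)) t
      have h2 := hpen t
      simp only [integral_add (hai _) (hwi _), Finset.sum_sub_distrib, Finset.sum_const,
        Finset.card_univ, Fintype.card_fin, nsmul_eq_mul] at h ⊢
      linarith
    nlinarith [mul_nonneg (sub_nonneg.2 hm2) hR]
  · have h : x / l - δ ≤ 10 * √(x * V) + 22 * x - δ - 2 * m * V := by linarith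
    have h2 := mul_le_mul_of_nonneg_left h hl.le
    rw [mul_sub, mul_div_cancel₀ _ hl.ne'] at h2
    nlinarith

end

lemma le_biSup_of_nonneg {α : Type*} {F : Set α} {g : α → ℝ} {C : ℝ} (h0 : ∀ f, 0 ≤ g f)
    (hC : ∀ f ∈ F, g f ≤ C) {f : α} (hf : f ∈ F) : g f ≤ ⨆ f ∈ F, g f := by
  have hb : BddAbove (Set.range fun f => ⨆ _ : f ∈ F, g f) := by
    refine ⟨C, ?_⟩
    rintro _ ⟨f', rfl⟩
    exact Real.iSup_le (hC f') ((h0 f).trans (hC f hf))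
  refine le_trans ?_ (le_ciSup hb f)
  simp [hf]

lemma exists_lt_of_lt_biSup {α : Type*} {F : Set α} (hF : F.Nonempty) {g : α → ℝ}
    (h0 : ∀ f, 0 ≤ g f) {c : ℝ} (hc : c < ⨆ f ∈ F, g f) : ∃ f ∈ F, c < g f := by
  by_contra! h
  obtain ⟨f, hf⟩ := hF
  exact hc.not_ge (Real.iSup_le (fun f => Real.iSup_le (h f) ((h0 _).trans (h _ ‹_›)))
    ((h0 f).trans (h f hf)))

/-- Symmetrization of the first `k + 1` members of a sequence of functions. -/
def signedFamily {S : Type*} (f : ℕ → S → ℝ) (k : ℕ) (t : Fin (k + 1) × Bool) : S → ℝ :=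
  fun s => boolSign t.2 * f t.1 s

lemma sum_signedFamily {S : Type*} (f : ℕ → S → ℝ) (k n : ℕ) (t : Fin (k + 1) × Bool)
    (e : Fin n → ℝ) (X : Fin n → S) :
    ∑ i, e i * signedFamily f k t (X i) = boolSign t.2 * ∑ i, e i * f t.1 (X i) := by
  simp only [signedFamily, Finset.mul_sum]
  exact Finset.sum_congr rfl fun i _ => by ring

lemma sum_signedFamily_sub {S : Type*} [MeasurableSpace S] (P : Measure S) (f : ℕ → S → ℝ)
    (k n : ℕ) (t : Fin (k + 1) × Bool) (X : Fin n → S) :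
    ∑ i, (signedFamily f k t (X i) - ∫ s, signedFamily f k t s ∂P) =
      boolSign t.2 * ∑ i, (f t.1 (X i) - ∫ s, f t.1 s ∂P) := by
  simp only [signedFamily, integral_const_mul, Finset.mul_sum, mul_sub]

lemma boolSign_mul_le_abs (b : Bool) (y : ℝ) : boolSign b * y ≤ |y| := by
  cases b <;> simp [boolSign, le_abs_self, neg_le_abs]

lemma exists_boolSign_mul_eq_abs (y : ℝ) : ∃ b, boolSign b * y = |y| := by
  rcases abs_choice y with h | h
  · exact ⟨true, by simp [boolSign, h]⟩
  · exact ⟨false, by simp [boolSign, h]⟩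

lemma measure_signedFamily_le {S : Type*} [MeasurableSpace S] {P : Measure S}
    [IsProbabilityMeasure P] {f : ℕ → S → ℝ} (hfm : ∀ j, Measurable (f j))
    (hfb : ∀ j s, |f j s| ≤ 1 / 2) {σ2 : ℝ} (hσ : ∀ j, ∫ s, f j s ^ 2 ∂P ≤ σ2) (n k : ℕ)
    {x δ : ℝ} (hx : 0 < x) (hδ : 0 ≤ δ) :
    (Measure.pi fun _ : Fin n => P).prod (Measure.pi fun _ : Fin n => radMeasure)
      {ω | 6 * (⨆ t, ∑ i, ω.2 i * signedFamily f k t (ω.1 i)) + 10 * √(x * (n * σ2)) + 22 * x - δ ≤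
        ⨆ t, ∑ i, (signedFamily f k t (ω.1 i) - ∫ s, signedFamily f k t s ∂P)} ≤
      ENNReal.ofReal (Real.exp (δ - x)) := by
  have hs : ∀ b, |boolSign b| = 1 := fun b => by cases b <;> simp [boolSign]
  refine measure_finite_le (a := signedFamily f k) n (fun t => (hfm _).const_mul _)
    (fun t s => ?_) (fun t => ?_) (fun t => ?_) hx hδ
  · rw [signedFamily, abs_mul, hs, one_mul]
    exact hfb _ _
  · refine ⟨(t.1, !t.2), funext fun s => ?_⟩
    obtain ⟨j, b⟩ := t
    cases b <;> simp [signedFamily, boolSign]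
  · simp only [signedFamily, mul_pow, ← sq_abs (boolSign _), hs, one_pow, one_mul]
    exact mul_le_mul_of_nonneg_left (hσ _) n.cast_nonneg

/-- **Proposition 5.** Bernstein-type concentration inequality with a Rademacher
symmetrized data-driven bound. -/
theorem rademacher_bernstein_inequality
    {S : Type*} [MeasurableSpace S] (P : Measure S) [IsProbabilityMeasure P]
    (F : Set (S → ℝ)) (hFc : F.Countable) (hFm : ∀ f ∈ F, Measurable f)
    (hFb : ∀ f ∈ F, ∀ s : S, |f s| ≤ 1 / 2)
    (σ2 : ℝ) (hσ : ∀ f ∈ F, (∫ s, (f s) ^ 2 ∂P) ≤ σ2)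
    (n : ℕ) (hn : 1 ≤ n) (x : ℝ) (hx : 0 < x) :
    (Measure.pi fun _ : Fin n => P).prod (Measure.pi fun _ : Fin n => radMeasure)
        {ω : (Fin n → S) × (Fin n → ℝ) |
          6 * (⨆ f ∈ F, |(1 / (n : ℝ)) * ∑ i : Fin n, ω.2 i * f (ω.1 i)|) +
              10 * Real.sqrt ((x + Real.log 2) * σ2 / n) +
              22 * (x + Real.log 2) / n ≤
            ⨆ f ∈ F, |(1 / (n : ℝ)) * ∑ i : Fin n, (f (ω.1 i) - ∫ s, f s ∂P)|} ≤
      ENNReal.ofReal (Real.exp (-x)) := by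
  have hn0 : (0 : ℝ) < n := by exact_mod_cast hn
  have hlog : 0 < Real.log 2 := Real.log_pos one_lt_two
  set x' := x + Real.log 2 with hx'
  have hxpos : 0 < x' := by positivity
  rcases F.eq_empty_or_nonempty with rfl | hF
  · refine le_trans (le_of_eq ?_) zero_le
    convert measure_empty (μ := (Measure.pi fun _ : Fin n => P).prod
      (Measure.pi fun _ : Fin n => radMeasure))
    refine Set.eq_empty_of_forall_notMem fun ω hω => ?_
    have h : 0 < 10 * √(x' * σ2 / n) + 22 * x' / n := by positivity
    have hz : ∀ g : (S → ℝ) → ℝ, ⨆ f ∈ (∅ : Set (S → ℝ)), g f = 0 := by simp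
    rw [Set.mem_ofPred_eq, hz, hz] at hω
    linarith
  obtain ⟨f, rfl⟩ := hFc.exists_eq_range hF
  have hfm : ∀ j, Measurable (f j) := fun j => hFm _ (Set.mem_range_self j)
  have hfb : ∀ j s, |f j s| ≤ 1 / 2 := fun j => hFb _ (Set.mem_range_self j)
  have hfσ : ∀ j, ∫ s, f j s ^ 2 ∂P ≤ σ2 := fun j => hσ _ (Set.mem_range_self j)
  set E : ℕ → Set ((Fin n → S) × (Fin n → ℝ)) := fun k =>
    {ω | 6 * (⨆ t, ∑ i, ω.2 i * signedFamily f k t (ω.1 i)) + 10 * √(x' * (n * σ2)) + 22 * x' -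
      Real.log 2 ≤ ⨆ t, ∑ i, (signedFamily f k t (ω.1 i) - ∫ s, signedFamily f k t s ∂P)}
  have hE : ∀ k, (Measure.pi fun _ : Fin n => P).prod (Measure.pi fun _ : Fin n => radMeasure)
      (E k) ≤ ENNReal.ofReal (Real.exp (-x)) := fun k => by
    have h := measure_signedFamily_le (P := P) hfm hfb hfσ n k hxpos hlog.le
    rwa [hx', show Real.log 2 - (x + Real.log 2) = -x by ring, ← hx'] at h
  have hmono : Monotone fun j => ⋂ k ≥ j, E k := fun j j' hj =>
    Set.biInter_subset_biInter_left fun k hk => le_trans hj hk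
  refine le_trans (measure_mono (t := ⋃ j, ⋂ k ≥ j, E k) fun ω hω => ?_) ?_
  · simp only [Set.mem_ofPred_eq] at hω
    set R := ⨆ g ∈ Set.range f, |(1 / (n : ℝ)) * ∑ i : Fin n, ω.2 i * g (ω.1 i)| with hR
    have hsqrt : √(x' * σ2 / n) * n = √(x' * (n * σ2)) := by
      rw [← Real.sqrt_sq hn0.le, ← Real.sqrt_mul' _ (sq_nonneg _), Real.sqrt_sq hn0.le]
      congr 1
      field_simp
    have hlt : 6 * R + 10 * √(x' * σ2 / n) + 22 * x' / n - Real.log 2 / n <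
        ⨆ g ∈ Set.range f, |(1 / (n : ℝ)) * ∑ i : Fin n, (g (ω.1 i) - ∫ s, g s ∂P)| :=
      lt_of_lt_of_le (sub_lt_self _ (by positivity)) hω
    obtain ⟨_, ⟨j, rfl⟩, hj⟩ := exists_lt_of_lt_biSup hF (fun _ => abs_nonneg _) hlt
    have habs : ∀ y : ℝ, |1 / (n : ℝ) * y| * n = |y| := fun y => by
      rw [abs_mul, abs_of_pos (by positivity : (0 : ℝ) < 1 / n)]
      field_simp
    have hRle : ∀ i, |∑ m, ω.2 m * f i (ω.1 m)| ≤ R * n := fun i => by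
      rw [← habs]
      refine mul_le_mul_of_nonneg_right ?_ hn0.le
      refine le_biSup_of_nonneg (C := 1 / n * ∑ m, |ω.2 m| * (1 / 2))
        (g := fun g : S → ℝ => |1 / (n : ℝ) * ∑ m, ω.2 m * g (ω.1 m)|)
        (fun _ => abs_nonneg _) ?_ (Set.mem_range_self i)
      rintro _ ⟨i, rfl⟩
      rw [abs_mul, abs_of_pos (by positivity : (0 : ℝ) < 1 / n)]
      refine mul_le_mul_of_nonneg_left ((Finset.abs_sum_le_sum_abs _ _).trans
        (Finset.sum_le_sum fun m _ => ?_)) (by positivity)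
      rw [abs_mul]
      exact mul_le_mul_of_nonneg_left (hfb _ _) (abs_nonneg _)
    refine Set.mem_iUnion.2 ⟨j, Set.mem_iInter₂.2 fun k hk => ?_⟩
    have h1 : ⨆ t, ∑ i, ω.2 i * signedFamily f k t (ω.1 i) ≤ R * n := ciSup_le fun t => by
      rw [sum_signedFamily]
      exact (boolSign_mul_le_abs _ _).trans (hRle _)
    have h2 : |∑ i, (f j (ω.1 i) - ∫ s, f j s ∂P)| ≤
        ⨆ t, ∑ i, (signedFamily f k t (ω.1 i) - ∫ s, signedFamily f k t s ∂P) := by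
      obtain ⟨b, hb⟩ := exists_boolSign_mul_eq_abs (∑ i, (f j (ω.1 i) - ∫ s, f j s ∂P))
      have h := le_iSup_of_finite
        (fun t => ∑ i, (signedFamily f k t (ω.1 i) - ∫ s, signedFamily f k t s ∂P))
        (⟨j, Nat.lt_succ_of_le hk⟩, b)
      simp only [sum_signedFamily_sub] at h ⊢
      exact hb.symm.trans_le h
    have h3 := mul_le_mul_of_nonneg_right hj.le hn0.le
    rw [habs, sub_mul, add_mul, add_mul, mul_assoc 10, hsqrt, div_mul_cancel₀ _ hn0.ne',
      div_mul_cancel₀ _ hn0.ne'] at h3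
    simp only [E, Set.mem_ofPred_eq]
    linarith
  · rw [hmono.measure_iUnion]
    exact iSup_le fun j => (measure_mono (Set.biInter_subset_of_mem (le_refl j))).trans (hE j)

end
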